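/- With the Calderón–Zygmund decomposition as in the context, fix an integer s ≥ 200 and w ∈ {0,1/2}^d. There exist constants C₀ and C' depending only on d and the constants C, c₁, c₂ such that, with the sets F_s^n defined using C₀, for every n ≥ 1 one has |F_s^n| ≤ C' 2^{−2n} λ^{−1} C_Ω ‖f‖_{L¹(ℝ^d)}. -/

import Mathlib

open MeasureTheory Metric Set FourierTransform
open scoped ENNReal RealInnerProductSpace

noncomputable section

abbrev Rd (d : ℕ) : Type := EuclideanSpace ℝ (Fin d)

/-- The dyadic cube `2^k w + ∏_i [m_i 2^k, (m_i+1) 2^k)` in the shifted grid `𝔇^w`. -/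
def dcube (d : ℕ) (w : Fin d → ℝ) (k : ℤ) (m : Fin d → ℤ) : Set (Rd d) :=
  {x | ∀ i : Fin d, (2:ℝ) ^ k * (w i + m i) ≤ x i ∧ x i < (2:ℝ) ^ k * (w i + m i + 1)}

/-- The concentric cube `½K` of half the sidelength. -/
def dhalf (d : ℕ) (w : Fin d → ℝ) (k : ℤ) (m : Fin d → ℤ) : Set (Rd d) :=
  {x | ∀ i : Fin d,
    (2:ℝ) ^ k * (w i + m i + 1/4) ≤ x i ∧ x i < (2:ℝ) ^ k * (w i + m i + 3/4)}

/-- `w ∈ {0, 1/2}^d`. -/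
def GridShift (d : ℕ) (w : Fin d → ℝ) : Prop := ∀ i, w i = 0 ∨ w i = 1/2

/-- The Calderón–Zygmund decomposition data at level `λ/C_Ω`: a countable collection
`Qset` of pairwise disjoint standard dyadic cubes and bad functions `b_Q` with
`supp b_Q ⊆ Q`, `∫ b_Q = 0`, `‖b_Q‖₁ ≤ C⟨f⟩_Q |Q|` and `⟨f⟩_Q ≈ λ/C_Ω`. -/
structure CZData (d : ℕ) (COm Cc c₁ c₂ : ℝ) (f : Rd d → ℝ) (lam : ℝ)
    (Qset : Set (ℤ × (Fin d → ℤ))) (b : ℤ × (Fin d → ℤ) → Rd d → ℝ) : Prop where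
  pairwise_disjoint : Qset.Pairwise fun q q' =>
    Disjoint (dcube d 0 q.1 q.2) (dcube d 0 q'.1 q'.2)
  support_subset : ∀ q ∈ Qset, Function.support (b q) ⊆ dcube d 0 q.1 q.2
  integrable : ∀ q ∈ Qset, Integrable (b q)
  integral_zero : ∀ q ∈ Qset, (∫ x, b q x) = 0
  l1_bound : ∀ q ∈ Qset, (∫ x, |b q x|) ≤ Cc * ∫ x in dcube d 0 q.1 q.2, |f x|
  avg_lower : ∀ q ∈ Qset, c₁ * lam / COm ≤
    (∫ x in dcube d 0 q.1 q.2, |f x|) / (volume (dcube d 0 q.1 q.2)).toReal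
  avg_upper : ∀ q ∈ Qset,
    (∫ x in dcube d 0 q.1 q.2, |f x|) / (volume (dcube d 0 q.1 q.2)).toReal ≤ c₂ * lam / COm

/-- `b_m = Σ_{Q ∈ 𝒬, l(Q) = 2^m} b_Q`. -/
def bsum (d : ℕ) (Qset : Set (ℤ × (Fin d → ℤ))) (b : ℤ × (Fin d → ℤ) → Rd d → ℝ)
    (m : ℤ) (x : Rd d) : ℝ :=
  ∑' mv : Fin d → ℤ, Set.indicator Qset (fun q => b q x) (m, mv)

/-- The exceptional sets `F_s^n`: `F_s^0 = ℝ^d` and `F_s^{n+1}` is the set where more than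
`C₀2^{ds}` of the cubes `K ∈ 𝔇^w` with `K ⊆ F_s^n` and `b_{k-s}χ_{½K} ≠ 0` pile up. -/
def Fset (d : ℕ) (w : Fin d → ℝ) (Qset : Set (ℤ × (Fin d → ℤ)))
    (b : ℤ × (Fin d → ℤ) → Rd d → ℝ) (s : ℕ) (C₀ : ℝ) : ℕ → Set (Rd d)
  | 0 => Set.univ
  | n + 1 =>
    {x | ENNReal.ofReal (C₀ * (2:ℝ) ^ (d * s)) <
      ∑' km : ℤ × (Fin d → ℤ),
        Set.indicator
          {km' : ℤ × (Fin d → ℤ) |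
            dcube d w km'.1 km'.2 ⊆ Fset d w Qset b s C₀ n ∧
            ¬ ((dhalf d w km'.1 km'.2).indicator (bsum d Qset b (km'.1 - (s : ℤ)))
                =ᵐ[(volume : Measure (Rd d))] (fun _ => (0:ℝ)))}
          (fun km' => (dcube d w km'.1 km'.2).indicator (fun _ => (1:ℝ≥0∞)) x) km}

/-- A grid cube as a preimage of a product of half-open intervals. -/
lemma dcube_eq_preimage (d : ℕ) (w : Fin d → ℝ) (k : ℤ) (m : Fin d → ℤ) :
    dcube d w k m = (MeasurableEquiv.toLp 2 (Fin d → ℝ)).symm ⁻¹' Set.univ.pi fun i =>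
      Set.Ico ((2:ℝ) ^ k * (w i + m i)) ((2:ℝ) ^ k * (w i + m i + 1)) := by
  ext x
  simp [dcube, Set.mem_pi]

lemma measurableSet_dcube (d : ℕ) (w : Fin d → ℝ) (k : ℤ) (m : Fin d → ℤ) :
    MeasurableSet (dcube d w k m) := by
  rw [dcube_eq_preimage]
  exact (MeasurableEquiv.measurable _) (MeasurableSet.univ_pi fun _ => measurableSet_Ico)

lemma volume_dcube (d : ℕ) (w : Fin d → ℝ) (k : ℤ) (m : Fin d → ℤ) :
    volume (dcube d w k m) = ENNReal.ofReal ((2:ℝ) ^ k) ^ d := by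
  rw [dcube_eq_preimage,
    (EuclideanSpace.volume_preserving_symm_measurableEquiv_toLp (Fin d)).measure_preimage_equiv,
    Real.volume_pi_Ico]
  have h : ∀ i, (2:ℝ) ^ k * (w i + m i + 1) - (2:ℝ) ^ k * (w i + m i) = (2:ℝ) ^ k := by
    intro i
    ring
  simp [h]

lemma volume_dcube_ne_top (d : ℕ) (w : Fin d → ℝ) (k : ℤ) (m : Fin d → ℤ) :
    volume (dcube d w k m) ≠ ∞ := by
  rw [volume_dcube]
  finiteness

lemma volume_dcube_pos (d : ℕ) (w : Fin d → ℝ) (k : ℤ) (m : Fin d → ℤ) :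
    0 < volume (dcube d w k m) := by
  rw [volume_dcube]
  have : (0:ℝ) < (2:ℝ) ^ k := by positivity
  exact pos_iff_ne_zero.2 (pow_ne_zero _ (by simpa using this))

lemma dcube_nonempty (d : ℕ) (w : Fin d → ℝ) (k : ℤ) (m : Fin d → ℤ) :
    (dcube d w k m).Nonempty :=
  nonempty_of_measure_ne_zero (volume_dcube_pos d w k m).ne'

/-- Passing from scale `k - s` to scale `k` multiplies the volume of a cube by `2^{ds}`. -/
lemma volume_dcube_eq_mul (d : ℕ) (w w' : Fin d → ℝ) (k : ℤ) (s : ℕ) (m m' : Fin d → ℤ) :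
    volume (dcube d w k m) =
      ENNReal.ofReal ((2:ℝ) ^ (d * s)) * volume (dcube d w' (k - s) m') := by
  rw [volume_dcube, volume_dcube, ← ENNReal.ofReal_pow (by positivity),
    ← ENNReal.ofReal_pow (by positivity), ← ENNReal.ofReal_mul (by positivity),
    mul_comm d s, pow_mul, ← mul_pow, zpow_sub₀ (two_ne_zero), zpow_natCast]
  congr 2
  field_simp

/-- Two cubes of the same grid and scale that share a point coincide. -/
lemma dcube_index_unique {d : ℕ} {w : Fin d → ℝ} {k : ℤ} {m m' : Fin d → ℤ} {x : Rd d}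
    (hx : x ∈ dcube d w k m) (hx' : x ∈ dcube d w k m') : m = m' := by
  have hk : (0:ℝ) < (2:ℝ) ^ k := by positivity
  funext i
  have h1 := lt_of_mul_lt_mul_left ((hx i).1.trans_lt (hx' i).2) hk.le
  have h2 := lt_of_mul_lt_mul_left ((hx' i).1.trans_lt (hx i).2) hk.le
  have h3 : (m i : ℝ) < ((m' i + 1 : ℤ) : ℝ) := by push_cast; linarith
  have h4 : (m' i : ℝ) < ((m i + 1 : ℤ) : ℝ) := by push_cast; linarith
  have h5 := Int.cast_lt.1 h3
  have h6 := Int.cast_lt.1 h4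
  omega

/-- A cube at least four times smaller than `K` that meets `½K` is contained in `K`. -/
lemma dcube_subset_of_mem_dhalf {d : ℕ} {w w' : Fin d → ℝ} {k : ℤ} {s : ℕ} (hs : 2 ≤ s)
    {m m' : Fin d → ℤ} {x : Rd d}
    (hx : x ∈ dhalf d w k m) (hx' : x ∈ dcube d w' (k - s) m') :
    dcube d w' (k - s) m' ⊆ dcube d w k m := by
  intro y hy i
  have hh : (0:ℝ) < (2:ℝ) ^ (k - (s:ℤ)) := by positivity
  have hk : (2:ℝ) ^ k = (2:ℝ) ^ (k - (s:ℤ)) * 2 ^ s := by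
    rw [← zpow_natCast, ← zpow_add₀ two_ne_zero]
    simp
  have h4 : (4:ℝ) ≤ 2 ^ s := by
    calc (4:ℝ) = 2 ^ 2 := by norm_num
      _ ≤ 2 ^ s := pow_le_pow_right₀ (by norm_num) hs
  obtain ⟨a1, a2⟩ := hx i
  obtain ⟨b1, b2⟩ := hx' i
  obtain ⟨y1, y2⟩ := hy i
  rw [hk] at a1 a2 ⊢
  have h5 := mul_le_mul_of_nonneg_left h4 hh.le
  constructor <;> linarith

/-- If `b_m` does not vanish a.e. on `½K`, then `½K` meets a selected cube of side `2^m`. -/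
lemma exists_mem_of_bsum_ne_zero {d : ℕ} {COm Cc c₁ c₂ : ℝ} {f : Rd d → ℝ} {lam : ℝ}
    {Qset : Set (ℤ × (Fin d → ℤ))} {b : ℤ × (Fin d → ℤ) → Rd d → ℝ}
    (hcz : CZData d COm Cc c₁ c₂ f lam Qset b) {m : ℤ} {A : Set (Rd d)}
    (h : ¬ (A.indicator (bsum d Qset b m) =ᵐ[(volume : Measure (Rd d))] fun _ => (0:ℝ))) :
    ∃ mv, (m, mv) ∈ Qset ∧ ∃ x ∈ A, x ∈ dcube d 0 m mv := by
  contrapose! h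
  refine Filter.Eventually.of_forall fun x => ?_
  by_cases hx : x ∈ A
  · rw [Set.indicator_of_mem hx, bsum]
    refine (tsum_congr fun mv => ?_).trans tsum_zero
    refine Set.indicator_apply_eq_zero.2 fun hq => ?_
    by_contra hne
    exact h mv hq x hx (hcz.support_subset _ hq hne)
  · exact Set.indicator_of_notMem hx _

/-- The union of the selected cubes. -/
def selectedUnion (d : ℕ) (Qset : Set (ℤ × (Fin d → ℤ))) : Set (Rd d) :=
  ⋃ q ∈ Qset, dcube d 0 q.1 q.2

/-- The selected cubes have total measure at most `(c₁λ)⁻¹ C_Ω ‖f‖₁`. -/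
lemma volume_selectedUnion_le {d : ℕ} {COm Cc c₁ c₂ : ℝ} {f : Rd d → ℝ} {lam : ℝ}
    {Qset : Set (ℤ × (Fin d → ℤ))} {b : ℤ × (Fin d → ℤ) → Rd d → ℝ}
    (hcz : CZData d COm Cc c₁ c₂ f lam Qset b) (hC : 0 < COm) (hc : 0 < c₁) (hl : 0 < lam)
    (hf : Integrable f) :
    volume (selectedUnion d Qset) ≤
      ENNReal.ofReal (c₁⁻¹ * lam⁻¹ * COm * ∫ x : Rd d, |f x|) := by
  have hdisj : Qset.PairwiseDisjoint fun q => dcube d 0 q.1 q.2 := hcz.pairwise_disjoint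
  have hmeas : ∀ q ∈ Qset, MeasurableSet (dcube d 0 q.1 q.2) :=
    fun q _ => measurableSet_dcube _ _ _ _
  have hcount : Qset.Countable := Set.to_countable _
  have hA : 0 ≤ c₁⁻¹ * lam⁻¹ * COm := by positivity
  have hcube : ∀ q ∈ Qset, volume (dcube d 0 q.1 q.2) ≤
      ENNReal.ofReal (c₁⁻¹ * lam⁻¹ * COm) *
        ∫⁻ x in dcube d 0 q.1 q.2, ENNReal.ofReal |f x| := by
    intro q hq
    have hpos : 0 < (volume (dcube d 0 q.1 q.2)).toReal :=
      ENNReal.toReal_pos (volume_dcube_pos _ _ _ _).ne' (volume_dcube_ne_top _ _ _ _)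
    rw [← ofReal_integral_eq_lintegral_ofReal hf.abs.integrableOn
      (Filter.Eventually.of_forall fun x => abs_nonneg _), ← ENNReal.ofReal_mul hA,
      ← ENNReal.ofReal_toReal (volume_dcube_ne_top d 0 q.1 q.2)]
    apply ENNReal.ofReal_le_ofReal
    have h := hcz.avg_lower q hq
    rw [div_le_div_iff₀ hC hpos] at h
    rw [show c₁⁻¹ * lam⁻¹ * COm * (∫ x in dcube d 0 q.1 q.2, |f x|) =
      ((∫ x in dcube d 0 q.1 q.2, |f x|) * COm) / (c₁ * lam) by field_simp,
      le_div_iff₀ (by positivity)]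
    linarith
  calc volume (selectedUnion d Qset)
      = ∑' q : Qset, volume (dcube d 0 q.1.1 q.1.2) := measure_biUnion hcount hdisj hmeas
    _ ≤ ∑' q : Qset, ENNReal.ofReal (c₁⁻¹ * lam⁻¹ * COm) *
          ∫⁻ x in dcube d 0 q.1.1 q.1.2, ENNReal.ofReal |f x| :=
        ENNReal.tsum_le_tsum fun q => hcube q q.2
    _ = ENNReal.ofReal (c₁⁻¹ * lam⁻¹ * COm) *
          ∫⁻ x in selectedUnion d Qset, ENNReal.ofReal |f x| := by
        rw [ENNReal.tsum_mul_left, selectedUnion, lintegral_biUnion hcount hmeas hdisj]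
    _ ≤ ENNReal.ofReal (c₁⁻¹ * lam⁻¹ * COm) * ∫⁻ x, ENNReal.ofReal |f x| := by
        gcongr
        exact Measure.restrict_le_self
    _ = ENNReal.ofReal (c₁⁻¹ * lam⁻¹ * COm * ∫ x : Rd d, |f x|) := by
        rw [ENNReal.ofReal_mul hA, ofReal_integral_eq_lintegral_ofReal hf.abs
          (Filter.Eventually.of_forall fun x => abs_nonneg _)]

/-- One step of the iteration: `C₀ |F_s^{n+1}| ≤ |F_s^n ∩ ⋃ Q|`, by Chebyshev's inequality. -/
lemma mul_volume_Fset_succ_le {d : ℕ} {COm Cc c₁ c₂ : ℝ} {f : Rd d → ℝ} {lam : ℝ}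
    {Qset : Set (ℤ × (Fin d → ℤ))} {b : ℤ × (Fin d → ℤ) → Rd d → ℝ}
    (hcz : CZData d COm Cc c₁ c₂ f lam Qset b) {s : ℕ} (hs : 2 ≤ s) (w : Fin d → ℝ)
    {C₀ : ℝ} (hC₀ : 0 ≤ C₀) (n : ℕ) :
    ENNReal.ofReal C₀ * volume (Fset d w Qset b s C₀ (n + 1)) ≤
      volume (Fset d w Qset b s C₀ n ∩ selectedUnion d Qset) := by
  set S : Set (ℤ × (Fin d → ℤ)) := {km' : ℤ × (Fin d → ℤ) |
            dcube d w km'.1 km'.2 ⊆ Fset d w Qset b s C₀ n ∧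
            ¬ ((dhalf d w km'.1 km'.2).indicator (bsum d Qset b (km'.1 - (s : ℤ)))
                =ᵐ[(volume : Measure (Rd d))] (fun _ => (0:ℝ)))}
  have hsel : ∀ K : S, ∃ mv, (K.1.1 - (s:ℤ), mv) ∈ Qset ∧
      dcube d 0 (K.1.1 - (s:ℤ)) mv ⊆ dcube d w K.1.1 K.1.2 := by
    intro K
    obtain ⟨mv, hmv, x, hx, hx'⟩ := exists_mem_of_bsum_ne_zero hcz K.2.2
    exact ⟨mv, hmv, dcube_subset_of_mem_dhalf hs hx hx'⟩
  choose Q hQ hsub using hsel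
  have hinj : Function.Injective fun K : S => (K.1.1 - (s:ℤ), Q K) := by
    intro K K' h
    obtain ⟨h1, h2⟩ := Prod.mk.inj h
    have hk : K.1.1 = K'.1.1 := by omega
    obtain ⟨x, hx⟩ := dcube_nonempty d 0 (K.1.1 - (s:ℤ)) (Q K)
    have hxK := hsub K hx
    rw [h1, h2] at hx
    have hxK' := hsub K' hx
    rw [← hk] at hxK'
    exact Subtype.ext (Prod.ext hk (dcube_index_unique hxK hxK'))
  have hdisj : Pairwise fun K K' : S => Disjoint (dcube d 0 (K.1.1 - (s:ℤ)) (Q K))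
      (dcube d 0 (K'.1.1 - (s:ℤ)) (Q K')) :=
    fun K K' hne => hcz.pairwise_disjoint (hQ K) (hQ K') (hinj.ne hne)
  have hterm : ∀ km : ℤ × (Fin d → ℤ), Measurable fun x =>
      S.indicator (fun km' => (dcube d w km'.1 km'.2).indicator (fun _ => (1:ℝ≥0∞)) x) km := by
    intro km
    by_cases h : km ∈ S
    · simpa [h] using measurable_const.indicator (measurableSet_dcube d w km.1 km.2)
    · simp [h]
  have hlint : ∫⁻ x, ∑' km, S.indicator
        (fun km' => (dcube d w km'.1 km'.2).indicator (fun _ => (1:ℝ≥0∞)) x) km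
      = ∑' K : S, volume (dcube d w K.1.1 K.1.2) := by
    rw [lintegral_tsum fun km => (hterm km).aemeasurable,
      tsum_subtype S fun km => volume (dcube d w km.1 km.2)]
    refine tsum_congr fun km => ?_
    by_cases h : km ∈ S
    · simp [h, lintegral_indicator (measurableSet_dcube d w km.1 km.2)]
    · simp [h]
  have hcheb : ENNReal.ofReal (C₀ * (2:ℝ) ^ (d * s)) *
      volume (Fset d w Qset b s C₀ (n + 1)) ≤ ∑' K : S, volume (dcube d w K.1.1 K.1.2) := by
    rw [← hlint]
    refine le_trans ?_ (mul_meas_ge_le_lintegral (Measurable.tsum hterm)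
      (ENNReal.ofReal (C₀ * (2:ℝ) ^ (d * s))))
    gcongr
    intro x hx
    rw [Fset] at hx
    exact le_of_lt (Set.mem_ofPred_eq ▸ hx)
  have hsum : ∑' K : S, volume (dcube d w K.1.1 K.1.2) =
      ENNReal.ofReal ((2:ℝ) ^ (d * s)) *
        volume (⋃ K : S, dcube d 0 (K.1.1 - (s:ℤ)) (Q K)) := by
    rw [measure_iUnion hdisj fun _ => measurableSet_dcube _ _ _ _, ← ENNReal.tsum_mul_left]
    exact tsum_congr fun K => volume_dcube_eq_mul _ _ _ _ _ _ _
  have hunion : (⋃ K : S, dcube d 0 (K.1.1 - (s:ℤ)) (Q K)) ⊆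
      Fset d w Qset b s C₀ n ∩ selectedUnion d Qset :=
    Set.iUnion_subset fun K => Set.subset_inter ((hsub K).trans K.2.1)
      (Set.subset_biUnion_of_mem (u := fun q => dcube d 0 q.1 q.2) (hQ K))
  rw [hsum, ENNReal.ofReal_mul hC₀, mul_comm (ENNReal.ofReal C₀), mul_assoc] at hcheb
  have hpos : ENNReal.ofReal ((2:ℝ) ^ (d * s)) ≠ 0 := by
    rw [ENNReal.ofReal_ne_zero_iff]
    positivity
  exact ((ENNReal.mul_le_mul_iff_right hpos ENNReal.ofReal_ne_top).1 hcheb).trans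
    (measure_mono hunion)

/-- Measure estimate for the exceptional sets: `|F_s^n| ≲ 2^{-2n} λ^{-1} C_Ω ‖f‖_{L¹}`. -/
theorem Fset_measure_estimate :
    ∀ d : ℕ, 2 ≤ d →
    ∀ Cc c₁ c₂ : ℝ, 0 < Cc → 0 < c₁ → 0 < c₂ →
    ∃ C₀ : ℝ, 0 < C₀ ∧ ∃ C' : ℝ, 0 < C' ∧
      ∀ COm : ℝ, 0 < COm →
      ∀ f : Rd d → ℝ, Integrable f →
      ∀ lam : ℝ, 0 < lam →
      ∀ (Qset : Set (ℤ × (Fin d → ℤ))) (b : ℤ × (Fin d → ℤ) → Rd d → ℝ),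
        CZData d COm Cc c₁ c₂ f lam Qset b →
      ∀ s : ℕ, 200 ≤ s →
      ∀ w : Fin d → ℝ, GridShift d w →
      ∀ n : ℕ, 1 ≤ n →
        volume (Fset d w Qset b s C₀ n) ≤
          ENNReal.ofReal (C' * (2:ℝ) ^ (-(2 * (n:ℤ))) * lam⁻¹ * COm * ∫ x : Rd d, |f x|) := by
  intro d _ Cc c₁ c₂ _ hc₁ _
  refine ⟨4, by norm_num, c₁⁻¹, by positivity, ?_⟩
  intro COm hCOm f hf lam hlam Qset b hcz s hs w _ n hn
  have hpow : ∀ m : ℕ, (4:ℝ≥0∞) ^ m * volume (Fset d w Qset b s 4 m ∩ selectedUnion d Qset) ≤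
      volume (selectedUnion d Qset) := by
    intro m
    induction m with
    | zero => simpa using measure_mono inter_subset_right
    | succ m ih =>
      refine le_trans ?_ ih
      rw [pow_succ, mul_assoc]
      gcongr
      have h := mul_volume_Fset_succ_le hcz (by omega : 2 ≤ s) w (by norm_num : (0:ℝ) ≤ 4) m
      rw [ENNReal.ofReal_ofNat] at h
      refine le_trans ?_ h
      gcongr
      exact inter_subset_left
  obtain ⟨m, rfl⟩ : ∃ m, n = m + 1 := ⟨n - 1, by omega⟩
  have hstep := mul_volume_Fset_succ_le hcz (by omega : 2 ≤ s) w (by norm_num : (0:ℝ) ≤ 4) m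
  rw [ENNReal.ofReal_ofNat] at hstep
  have hmain : (4:ℝ≥0∞) ^ (m + 1) * volume (Fset d w Qset b s 4 (m + 1)) ≤
      ENNReal.ofReal (c₁⁻¹ * lam⁻¹ * COm * ∫ x : Rd d, |f x|) := by
    rw [pow_succ, mul_assoc]
    exact ((mul_le_mul_right hstep _).trans (hpow m)).trans
      (volume_selectedUnion_le hcz hCOm hc₁ hlam hf)
  have h4 : (2:ℝ) ^ (-(2 * ((m + 1 : ℕ) : ℤ))) = ((4:ℝ) ^ (m + 1))⁻¹ := by
    rw [zpow_neg, zpow_mul, zpow_natCast]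
    norm_num
  rw [h4, show c₁⁻¹ * ((4:ℝ) ^ (m + 1))⁻¹ * lam⁻¹ * COm * (∫ x : Rd d, |f x|) =
    (c₁⁻¹ * lam⁻¹ * COm * ∫ x : Rd d, |f x|) / 4 ^ (m + 1) by field_simp,
    ENNReal.ofReal_div_of_pos (by positivity), ENNReal.ofReal_pow (by norm_num),
    ENNReal.ofReal_ofNat, ENNReal.le_div_iff_mul_le (by simp) (by simp), mul_comm]
  exact hmain
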